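/- (Degradation factor of OKP-Alg(α), case 0 < α < 1.) For every α with 0 < α < 1, T · U · (α + γ^α − 1) = α · γ · ∫₀^1 Ψ_α(u) du; equivalently, the worst-case ratio U / ∫₀^1 Ψ_α(u)du equals (αγ/(α + γ^α − 1))·(ln γ + 1), so the degradation factor of OKP-Alg(α) with respect to OKP-Alg(1) is exactly αγ/(α + γ^α − 1). -/

import Mathlib

/-- The parametric threshold function `Psi α` for the online knapsack problem:
`Psi α z = L` for `z < T` and `Psi α z = min U (L * exp (α * (z/T - 1)))` for `z ≥ T`. -/
noncomputable def Psi (L U T α z : ℝ) : ℝ :=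
  if z < T then L else min U (L * Real.exp (α * (z / T - 1)))

theorem Psi_eq_of_le {L U T α z : ℝ} (hT : 0 < T) (hLU : L ≤ U) (hz : z ≤ T) :
    Psi L U T α z = L := by
  unfold Psi
  split_ifs with h
  · rfl
  · obtain rfl : z = T := le_antisymm hz (not_lt.1 h)
    simp [div_self hT.ne', hLU]

theorem Psi_eq_of_ge {L U T α z : ℝ} (hz : T ≤ z)
    (hU : L * Real.exp (α * (z / T - 1)) ≤ U) :
    Psi L U T α z = L * Real.exp (α * (z / T - 1)) := by
  rw [Psi, if_neg hz.not_gt, min_eq_right hU]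

theorem integral_mul_exp_mul_div_sub_one {L T α : ℝ} (hT : T ≠ 0) (hα : α ≠ 0) (b : ℝ) :
    ∫ u in T..b, L * Real.exp (α * (u / T - 1)) =
      L * T / α * (Real.exp (α * (b / T - 1)) - 1) := by
  have hderiv (x : ℝ) : HasDerivAt (fun u => L * T / α * Real.exp (α * (u / T - 1)))
      (L * Real.exp (α * (x / T - 1))) x := by
    have h := (((((hasDerivAt_id x).div_const T).sub_const 1).const_mul α).exp).const_mul
      (L * T / α)
    refine h.congr_deriv ?_
    simp only [id]
    field_simp
  have hint : IntervalIntegrable (fun u => L * Real.exp (α * (u / T - 1)))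
      MeasureTheory.volume T b :=
    Continuous.intervalIntegrable (by fun_prop) _ _
  rw [intervalIntegral.integral_eq_sub_of_hasDerivAt (fun x _ => hderiv x) hint]
  simp only [div_self hT, sub_self, mul_zero, Real.exp_zero]
  ring

/-- The integral of `Psi` when the exponential branch does not exceed `U` on `[T, 1]`. -/
theorem integral_Psi {L U T α : ℝ} (hL : 0 < L) (hT : 0 < T) (hT1 : T ≤ 1) (hα : 0 < α)
    (hU : L * Real.exp (α * (1 / T - 1)) ≤ U) :
    ∫ u in (0:ℝ)..1, Psi L U T α u =
      L * T + L * T / α * (Real.exp (α * (1 / T - 1)) - 1) := by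
  have hLU : L ≤ U := by
    refine le_trans (le_mul_of_one_le_right hL.le (Real.one_le_exp ?_)) hU
    exact mul_nonneg hα.le (sub_nonneg.2 ((one_le_div hT).2 hT1))
  have hleft : Set.EqOn (fun _ => L) (Psi L U T α) (Set.uIcc 0 T) := by
    intro u hu
    rw [Set.uIcc_of_le hT.le] at hu
    exact (Psi_eq_of_le hT hLU hu.2).symm
  have hright : Set.EqOn (fun u => L * Real.exp (α * (u / T - 1))) (Psi L U T α)
      (Set.uIcc T 1) := by
    intro u hu
    rw [Set.uIcc_of_le hT1] at hu
    refine (Psi_eq_of_ge hu.1 (le_trans ?_ hU)).symm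
    have := hu.2
    gcongr
  have hintl : IntervalIntegrable (Psi L U T α) MeasureTheory.volume 0 T :=
    (intervalIntegrable_const (c := L)).congr (hleft.mono Set.uIoc_subset_uIcc)
  have hintr : IntervalIntegrable (Psi L U T α) MeasureTheory.volume T 1 :=
    (Continuous.intervalIntegrable (by fun_prop) T 1).congr
      (hright.mono Set.uIoc_subset_uIcc)
  rw [← intervalIntegral.integral_add_adjacent_intervals hintl hintr,
    ← intervalIntegral.integral_congr hleft, ← intervalIntegral.integral_congr hright,
    integral_mul_exp_mul_div_sub_one hT.ne' hα.ne', intervalIntegral.integral_const]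
  simp [mul_comm]

/-- Degradation factor of `OKP-Alg(α)` for `0 < α < 1`:
`T * U * (α + γ^α - 1) = α * γ * ∫ u in 0..1, Psi α u` (real power), so the
degradation factor of `OKP-Alg(α)` w.r.t. `OKP-Alg(1)` is exactly
`α*γ/(α + γ^α - 1)`. -/
theorem OKP_degradation_factor_alpha_lt_one (L U γ T α : ℝ) (hL : 0 < L) (hLU : L < U)
    (hγ : γ = U / L) (hT : T = 1 / (Real.log γ + 1)) (hα1 : 0 < α) (hα2 : α < 1) :
    T * U * (α + γ ^ α - 1) = α * γ * ∫ u in (0:ℝ)..1, Psi L U T α u := by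
  have hγ1 : 1 < γ := by rw [hγ]; exact (one_lt_div hL).2 hLU
  have hU : U = L * γ := by rw [hγ]; field_simp
  have hlog : 0 < Real.log γ := Real.log_pos hγ1
  have hTpos : 0 < T := by rw [hT]; positivity
  have hT1 : T ≤ 1 := by
    rw [hT, div_le_one (by positivity)]
    linarith
  have hexp : Real.exp (α * (1 / T - 1)) = γ ^ α := by
    rw [Real.rpow_def_of_pos (by linarith), hT, one_div_one_div, add_sub_cancel_right, mul_comm]
  have hpow : γ ^ α ≤ γ := Real.rpow_le_self_of_one_le hγ1.le hα2.le
  have hbound : L * Real.exp (α * (1 / T - 1)) ≤ U := by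
    rw [hexp, hU]
    gcongr
  rw [integral_Psi hL hTpos hT1 hα1 hbound, hexp, hU]
  field_simp
  ring
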